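/- Let D be a positive even integer, let θ > 0, and let Θ be the D×D real antisymmetric invertible matrix consisting of D/2 diagonal 2×2 blocks [[0, θ], [−θ, 0]]. Then for all Schwartz functions f, g on ℝ^D the Moyal product f ⋆ g is again a Schwartz function on ℝ^D, and the Moyal product is associative: for all Schwartz functions f, g, h on ℝ^D, (f ⋆ g) ⋆ h = f ⋆ (g ⋆ h). -/

import Mathlib

open MeasureTheory Matrix

/-- The `D×D` real antisymmetric deformation matrix `Θ` consisting of `D/2` diagonal
`2×2` blocks `[[0, θ], [−θ, 0]]`. -/
noncomputable def thetaMatrix (D : ℕ) (θ : ℝ) : Matrix (Fin D) (Fin D) ℝ :=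
  Matrix.of fun i j =>
    if (i : ℕ) % 2 = 0 ∧ (j : ℕ) = (i : ℕ) + 1 then θ
    else if (i : ℕ) % 2 = 1 ∧ (j : ℕ) + 1 = (i : ℕ) then -θ
    else 0

/-- The Moyal product on `ℝ^D` with deformation matrix `Θ = thetaMatrix D θ`:
`(f ⋆ g)(x) = (π^D |det Θ|)⁻¹ ∫∫ f(x+y) g(x+z) e^{−2i y·(Θ⁻¹z)} dy dz`. -/
noncomputable def moyalProd (D : ℕ) (θ : ℝ) (f g : (Fin D → ℝ) → ℂ) :
    (Fin D → ℝ) → ℂ :=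
  fun x => ((Real.pi ^ D * |(thetaMatrix D θ).det| : ℝ) : ℂ)⁻¹ *
    ∫ y : Fin D → ℝ, ∫ z : Fin D → ℝ,
      f (x + y) * g (x + z) *
        Complex.exp (-2 * Complex.I * ((y ⬝ᵥ (thetaMatrix D θ)⁻¹.mulVec z : ℝ) : ℂ))

section MoyalAux

variable {E : Type} [NormedAddCommGroup E] [NormedSpace ℝ E]

/-- The phase `t ↦ exp (i t)`. -/
noncomputable def moyalPhase (t : ℝ) : ℂ := Complex.exp (Complex.I * (t : ℂ))

lemma moyalPhase_add (s t : ℝ) : moyalPhase (s + t) = moyalPhase s * moyalPhase t := by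
  simp only [moyalPhase, Complex.ofReal_add, mul_add, Complex.exp_add]

lemma norm_moyalPhase (t : ℝ) : ‖moyalPhase t‖ = 1 := by
  rw [moyalPhase, mul_comm]
  exact Complex.norm_exp_ofReal_mul_I t

lemma continuous_moyalPhase : Continuous moyalPhase := by
  unfold moyalPhase
  fun_prop

lemma moyalPhase_hasDerivAt (t : ℝ) :
    HasDerivAt moyalPhase (Complex.I * moyalPhase t) t := by
  have h : HasDerivAt (fun z : ℂ => Complex.exp (Complex.I * z))
      (Complex.I * Complex.exp (Complex.I * (t : ℂ))) (t : ℂ) := by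
    have := ((hasDerivAt_id (t : ℂ)).const_mul Complex.I).cexp
    simpa [mul_comm] using this
  exact h.comp_ofReal

lemma moyalPhase_iteratedDeriv (n : ℕ) :
    iteratedDeriv n moyalPhase = fun t => Complex.I ^ n * moyalPhase t := by
  induction n with
  | zero => simp
  | succ n ih =>
    rw [iteratedDeriv_succ, ih]
    ext t
    rw [((moyalPhase_hasDerivAt t).const_mul (Complex.I ^ n)).deriv]
    ring

lemma moyalPhase_temperate : Function.HasTemperateGrowth moyalPhase := by
  refine ⟨?_, fun n => ⟨0, 1, fun t => ?_⟩⟩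
  · unfold moyalPhase
    exact Complex.contDiff_exp.comp (contDiff_const.mul Complex.ofRealCLM.contDiff)
  · rw [norm_iteratedFDeriv_eq_norm_iteratedDeriv, moyalPhase_iteratedDeriv]
    simp [norm_moyalPhase]

/-- Decay of Schwartz functions with weight `(1 + ‖x‖)`. -/
lemma schwartz_decay' {F V : Type} [NormedAddCommGroup F] [NormedSpace ℝ F]
    [NormedAddCommGroup V] [NormedSpace ℝ V] (H : SchwartzMap F V) (k n : ℕ) :
    ∃ C : ℝ, 0 ≤ C ∧ ∀ x, (1 + ‖x‖) ^ k * ‖iteratedFDeriv ℝ n H x‖ ≤ C := by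
  refine ⟨_, ?_, fun x => SchwartzMap.one_add_le_sup_seminorm_apply (𝕜 := ℝ) (m := (k, n))
    le_rfl le_rfl H x⟩
  positivity

lemma norm_iteratedFDeriv_comp_clm_le {F V : Type} [NormedAddCommGroup F] [NormedSpace ℝ F]
    [NormedAddCommGroup V] [NormedSpace ℝ V] (L : F →L[ℝ] E) (hL : ‖L‖ ≤ 1)
    (f : SchwartzMap E V) (i : ℕ) (x : F) :
    ‖iteratedFDeriv ℝ i (fun x => f (L x)) x‖ ≤ ‖iteratedFDeriv ℝ i f (L x)‖ := by
  have := L.iteratedFDeriv_comp_right (f.smooth i) x (i := i) le_rfl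
  change ‖iteratedFDeriv ℝ i (f ∘ L) x‖ ≤ _
  rw [this]
  refine (ContinuousMultilinearMap.norm_compContinuousLinearMap_le _ _).trans ?_
  refine mul_le_of_le_one_right (norm_nonneg _) ?_
  simpa using pow_le_one₀ (norm_nonneg _) hL

/-- External product of Schwartz functions. -/
lemma schwartz_tensor (f g : SchwartzMap E ℂ) :
    ∃ H : SchwartzMap (E × E) ℂ, ∀ p, H p = f p.1 * g p.2 := by
  have hf : ContDiff ℝ (⊤ : ℕ∞) (fun p : E × E => f p.1) := (f.smooth ⊤).comp contDiff_fst
  have hg : ContDiff ℝ (⊤ : ℕ∞) (fun p : E × E => g p.2) := (g.smooth ⊤).comp contDiff_snd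
  refine ⟨⟨fun p => f p.1 * g p.2, hf.mul hg, fun k n => ?_⟩, fun p => rfl⟩
  choose Cf hCf0 hCf using fun i => schwartz_decay' f k i
  choose Cg hCg0 hCg using fun i => schwartz_decay' g k i
  refine ⟨∑ i ∈ Finset.range (n + 1), (n.choose i : ℝ) * Cf i * Cg (n - i), fun p => ?_⟩
  have h1 := norm_iteratedFDeriv_mul_le hf hg p (n := n) (by exact_mod_cast le_top)
  refine (mul_le_mul_of_nonneg_left h1 (by positivity)).trans ?_
  rw [Finset.mul_sum]
  refine Finset.sum_le_sum fun i _ => ?_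
  have h2 : ‖iteratedFDeriv ℝ i (fun p : E × E => f p.1) p‖ ≤ ‖iteratedFDeriv ℝ i f p.1‖ :=
    norm_iteratedFDeriv_comp_clm_le (ContinuousLinearMap.fst ℝ E E)
      (ContinuousLinearMap.norm_fst_le ..) f i p
  have h3 : ‖iteratedFDeriv ℝ (n - i) (fun p : E × E => g p.2) p‖
      ≤ ‖iteratedFDeriv ℝ (n - i) g p.2‖ :=
    norm_iteratedFDeriv_comp_clm_le (ContinuousLinearMap.snd ℝ E E)
      (ContinuousLinearMap.norm_snd_le ..) g (n - i) p
  have h4 : ‖p‖ ^ k ≤ (1 + ‖p.1‖) ^ k * (1 + ‖p.2‖) ^ k := by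
    rw [← mul_pow]
    refine pow_le_pow_left₀ (norm_nonneg _) ?_ k
    rw [Prod.norm_def]
    have := norm_nonneg p.1
    have := norm_nonneg p.2
    refine max_le ?_ ?_ <;> nlinarith [mul_nonneg (norm_nonneg p.1) (norm_nonneg p.2)]
  calc ‖p‖ ^ k * ((n.choose i : ℝ) * ‖iteratedFDeriv ℝ i (fun p : E × E => f p.1) p‖ *
        ‖iteratedFDeriv ℝ (n - i) (fun p : E × E => g p.2) p‖)
      ≤ ((1 + ‖p.1‖) ^ k * (1 + ‖p.2‖) ^ k) * ((n.choose i : ℝ) * ‖iteratedFDeriv ℝ i f p.1‖ *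
        ‖iteratedFDeriv ℝ (n - i) g p.2‖) := by gcongr
    _ = (n.choose i : ℝ) * ((1 + ‖p.1‖) ^ k * ‖iteratedFDeriv ℝ i f p.1‖) *
        ((1 + ‖p.2‖) ^ k * ‖iteratedFDeriv ℝ (n - i) g p.2‖) := by ring
    _ ≤ _ := by
        have := hCf i p.1
        have := hCg (n - i) p.2
        have := hCf0 i
        gcongr

/-- The twisted integrand is Schwartz on the product space. -/
lemma schwartz_twisted (f G : SchwartzMap E ℂ) (B : E →L[ℝ] E →L[ℝ] ℝ) :
    ∃ H : SchwartzMap (E × E) ℂ, ∀ x y,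
      H (x, y) = f (x + y) * G y * moyalPhase (2 * B y x) := by
  obtain ⟨K, hK⟩ := schwartz_tensor f G
  let s : (E × E) ≃L[ℝ] (E × E) := ContinuousLinearEquiv.equivOfInverse
    ((ContinuousLinearMap.fst ℝ E E + ContinuousLinearMap.snd ℝ E E).prod
      (ContinuousLinearMap.snd ℝ E E))
    ((ContinuousLinearMap.fst ℝ E E - ContinuousLinearMap.snd ℝ E E).prod
      (ContinuousLinearMap.snd ℝ E E))
    (fun p => by simp) (fun p => by simp)
  have hq : Function.HasTemperateGrowth (fun p : E × E => ((2 : ℝ) • B) p.2 p.1) :=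
    ((2 : ℝ) • B).bilinear_hasTemperateGrowth (ContinuousLinearMap.snd ℝ E E).hasTemperateGrowth
      (ContinuousLinearMap.fst ℝ E E).hasTemperateGrowth
  have hph := moyalPhase_temperate.comp hq
  refine ⟨SchwartzMap.smulLeftCLM ℂ (moyalPhase ∘ fun p : E × E => ((2 : ℝ) • B) p.2 p.1)
    (SchwartzMap.compCLMOfContinuousLinearEquiv ℝ s K), fun x y => ?_⟩
  rw [SchwartzMap.smulLeftCLM_apply_apply hph, SchwartzMap.compCLMOfContinuousLinearEquiv_apply]
  have : s (x, y) = (x + y, y) := rfl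
  simp only [Function.comp_apply, this, hK, smul_eq_mul, _root_.smul_apply]
  ring

set_option linter.unusedSectionVars false

variable [FiniteDimensional ℝ E] [MeasurableSpace E] [BorelSpace E]
  (μ : Measure E) [μ.IsAddHaarMeasure]

lemma schwartz_slice_bound {V : Type} [NormedAddCommGroup V] [NormedSpace ℝ V]
    (H : SchwartzMap (E × E) V) (k : ℕ) :
    ∃ C : ℝ, ∀ x y, (1 + ‖x‖) ^ k * ‖H (x, y)‖ ≤
      C * (1 + ‖y‖) ^ (-(μ.integrablePower : ℝ)) := by
  obtain ⟨C, hC0, hC⟩ := schwartz_decay' H (k + μ.integrablePower) 0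
  refine ⟨C, fun x y => ?_⟩
  have h := hC (x, y)
  rw [norm_iteratedFDeriv_zero] at h
  have hy : 0 < 1 + ‖y‖ := by positivity
  rw [Real.rpow_neg hy.le, Real.rpow_natCast, ← div_eq_mul_inv, le_div_iff₀ (by positivity)]
  refine le_trans ?_ h
  have e1 : ‖x‖ ≤ ‖(x, y)‖ := le_max_left _ _
  have e2 : ‖y‖ ≤ ‖(x, y)‖ := le_max_right _ _
  calc (1 + ‖x‖) ^ k * ‖H (x, y)‖ * (1 + ‖y‖) ^ μ.integrablePower
      = (1 + ‖x‖) ^ k * (1 + ‖y‖) ^ μ.integrablePower * ‖H (x, y)‖ := by ring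
    _ ≤ (1 + ‖(x, y)‖) ^ k * (1 + ‖(x, y)‖) ^ μ.integrablePower * ‖H (x, y)‖ := by gcongr
    _ = _ := by rw [pow_add]

lemma schwartz_slice_integrable {V : Type} [NormedAddCommGroup V] [NormedSpace ℝ V]
    (H : SchwartzMap (E × E) V) (x : E) : Integrable (fun y => H (x, y)) μ := by
  obtain ⟨C, hC⟩ := schwartz_slice_bound μ H 0
  refine Integrable.mono' ((Measure.integrable_pow_neg_integrablePower μ).const_mul C) ?_
    (Filter.Eventually.of_forall fun y => by simpa using hC x y)
  exact (H.continuous.comp (by fun_prop)).aestronglyMeasurable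

lemma schwartz_slice_hasFDerivAt {V : Type} [NormedAddCommGroup V] [NormedSpace ℝ V]
    (H : SchwartzMap (E × E) V) (H' : SchwartzMap (E × E) (E →L[ℝ] V))
    (hH' : ∀ p, H' p = (fderiv ℝ H p).comp (ContinuousLinearMap.inl ℝ E E)) (x : E) :
    HasFDerivAt (fun x => ∫ y, H (x, y) ∂μ) (∫ y, H' (x, y) ∂μ) x := by
  obtain ⟨C, hC⟩ := schwartz_slice_bound μ H' 0
  refine hasFDerivAt_integral_of_dominated_of_fderiv_le (𝕜 := ℝ) (s := Set.univ)
    (F := fun x y => H (x, y)) (F' := fun x y => H' (x, y))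
    (bound := fun y => C * (1 + ‖y‖) ^ (-(μ.integrablePower : ℝ))) Filter.univ_mem
    (Filter.Eventually.of_forall fun x => (schwartz_slice_integrable μ H x).aestronglyMeasurable)
    (schwartz_slice_integrable μ H x) (schwartz_slice_integrable μ H' x).aestronglyMeasurable
    (Filter.Eventually.of_forall fun y x _ => by simpa using hC x y)
    ((Measure.integrable_pow_neg_integrablePower μ).const_mul C)
    (Filter.Eventually.of_forall fun y x _ => ?_)
  rw [hH']
  exact (H.hasFDerivAt (x, y)).comp x (hasFDerivAt_prodMk_left x y)

lemma schwartz_slice_aux (n : ℕ) : ∀ (V : Type) [NormedAddCommGroup V] [NormedSpace ℝ V]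
    (H : SchwartzMap (E × E) V),
    ContDiff ℝ n (fun x => ∫ y, H (x, y) ∂μ) ∧
    ∀ k : ℕ, ∃ C : ℝ, ∀ x, ‖x‖ ^ k * ‖iteratedFDeriv ℝ n (fun x => ∫ y, H (x, y) ∂μ) x‖ ≤ C := by
  have key : ∀ (V : Type) [NormedAddCommGroup V] [NormedSpace ℝ V] (H : SchwartzMap (E × E) V),
      ∃ H' : SchwartzMap (E × E) (E →L[ℝ] V), ∀ x,
        HasFDerivAt (fun x => ∫ y, H (x, y) ∂μ) (∫ y, H' (x, y) ∂μ) x := by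
    intro V _ _ H
    let L : (E × E →L[ℝ] V) →L[ℝ] (E →L[ℝ] V) :=
      (ContinuousLinearMap.compL ℝ E (E × E) V).flip (ContinuousLinearMap.inl ℝ E E)
    refine ⟨SchwartzMap.postcompCLM L (SchwartzMap.fderivCLM ℝ (E × E) V H), fun x => ?_⟩
    exact schwartz_slice_hasFDerivAt μ H _ (fun p => rfl) x
  induction n with
  | zero =>
    intro V _ _ H
    obtain ⟨H', hH'⟩ := key V H
    constructor
    · have : Differentiable ℝ (fun x => ∫ y, H (x, y) ∂μ) := fun x => (hH' x).differentiableAt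
      simpa using this.continuous
    · intro k
      obtain ⟨C, hC⟩ := schwartz_slice_bound μ H k
      refine ⟨∫ y, C * (1 + ‖y‖) ^ (-(μ.integrablePower : ℝ)) ∂μ, fun x => ?_⟩
      rw [norm_iteratedFDeriv_zero]
      calc ‖x‖ ^ k * ‖∫ y, H (x, y) ∂μ‖ ≤ ‖x‖ ^ k * ∫ y, ‖H (x, y)‖ ∂μ := by
            gcongr
            exact norm_integral_le_integral_norm _
        _ = ∫ y, ‖x‖ ^ k * ‖H (x, y)‖ ∂μ := (integral_const_mul _ _).symm
        _ ≤ _ := by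
            refine integral_mono ((schwartz_slice_integrable μ H x).norm.const_mul _)
              ((Measure.integrable_pow_neg_integrablePower μ).const_mul C) fun y => ?_
            refine le_trans ?_ (hC x y)
            have : ‖x‖ ≤ 1 + ‖x‖ := by linarith
            dsimp only
            gcongr
  | succ n ih =>
    intro V _ _ H
    obtain ⟨H', hH'⟩ := key V H
    have hfd : fderiv ℝ (fun x => ∫ y, H (x, y) ∂μ) = fun x => ∫ y, H' (x, y) ∂μ :=
      funext fun x => (hH' x).fderiv
    obtain ⟨h1, h2⟩ := ih _ H'
    constructor
    · push_cast
      rw [contDiff_succ_iff_fderiv]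
      refine ⟨fun x => (hH' x).differentiableAt, fun h => ?_, ?_⟩
      · exact absurd h (by simp)
      · rw [hfd]; exact h1
    · intro k
      obtain ⟨C, hC⟩ := h2 k
      refine ⟨C, fun x => ?_⟩
      rw [← norm_iteratedFDeriv_fderiv, hfd]
      exact hC x

/-- Integrating out one variable of a Schwartz function gives a Schwartz function. -/
lemma schwartz_integrate_out (H : SchwartzMap (E × E) ℂ) :
    ∃ p : SchwartzMap E ℂ, ∀ x, p x = ∫ y, H (x, y) ∂μ :=
  ⟨⟨fun x => ∫ y, H (x, y) ∂μ, contDiff_infty.2 fun n => (schwartz_slice_aux μ n ℂ H).1,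
    fun k n => (schwartz_slice_aux μ n ℂ H).2 k⟩, fun _ => rfl⟩


/-- Symplectic Fourier transform. -/
noncomputable def moyalS (B : E →L[ℝ] E →L[ℝ] ℝ) (g : E → ℂ) (y : E) : ℂ :=
  ∫ w, g w * moyalPhase (-(2 * B y w)) ∂μ

/-- Twisted correlation. -/
noncomputable def moyalR (B : E →L[ℝ] E →L[ℝ] ℝ) (c : ℂ) (f G : E → ℂ) (x : E) : ℂ :=
  c * ∫ y, f (x + y) * G y * moyalPhase (2 * B y x) ∂μ

lemma moyal_eq_moyalR (B : E →L[ℝ] E →L[ℝ] ℝ) (c : ℂ) (f g : E → ℂ) (x : E) :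
    c * ∫ y, ∫ z, f (x + y) * g (x + z) * moyalPhase (-(2 * B y z)) ∂μ ∂μ =
      moyalR μ B c f (moyalS μ B g) x := by
  unfold moyalR
  congr 1
  refine integral_congr_ae (Filter.Eventually.of_forall fun y => ?_)
  dsimp only
  have h : ∀ z, f (x + y) * g (x + z) * moyalPhase (-(2 * B y z)) =
      (f (x + y) * moyalPhase (2 * B y x)) *
        ((fun w => g w * moyalPhase (-(2 * B y w))) (x + z)) := by
    intro z
    have : -(2 * B y z) = 2 * B y x + -(2 * B y (x + z)) := by
      rw [map_add]; ring
    rw [this, moyalPhase_add]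
    ring
  simp_rw [h]
  rw [integral_const_mul, integral_add_left_eq_self (μ := μ)
    (fun w => g w * moyalPhase (-(2 * B y w))) x]
  unfold moyalS
  ring

/-- Twisted convolution. -/
noncomputable def moyalT (B : E →L[ℝ] E →L[ℝ] ℝ) (c : ℂ) (G H : E → ℂ) (w : E) : ℂ :=
  c * ∫ y, G (w - y) * H y * moyalPhase (2 * B (w - y) y) ∂μ

lemma continuous_bphase (B : E →L[ℝ] E →L[ℝ] ℝ) {X : Type} [TopologicalSpace X] {a b : X → E}
    (ha : Continuous a) (hb : Continuous b) (r : ℝ) :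
    Continuous fun x => moyalPhase (r * B (a x) (b x)) := by
  refine continuous_moyalPhase.comp ?_
  fun_prop

lemma moyalS_moyalR (B : E →L[ℝ] E →L[ℝ] ℝ) (c : ℂ) (g H : SchwartzMap E ℂ) (w : E) :
    moyalS μ B (moyalR μ B c g H) w = moyalT μ B c (moyalS μ B g) H w := by
  obtain ⟨K, hK⟩ := schwartz_twisted g H B
  have hint : Integrable (Function.uncurry fun x y =>
      g (x + y) * H y * moyalPhase (2 * B y x) * moyalPhase (-(2 * B w x))) (μ.prod μ) := by
    have h1 : Integrable K (μ.prod μ) := K.integrable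
    have h2 := h1.bdd_mul (f := fun p : E × E => moyalPhase ((-2) * B w p.1)) (c := 1)
      (continuous_bphase B continuous_const continuous_fst _).aestronglyMeasurable
      (Filter.Eventually.of_forall fun p => (norm_moyalPhase _).le)
    refine h2.congr (Filter.Eventually.of_forall fun p => ?_)
    obtain ⟨x, y⟩ := p
    simp only [Function.uncurry_apply_pair, hK]
    rw [mul_comm, neg_mul]
  unfold moyalS moyalR moyalT
  have e1 : ∀ x, (c * ∫ y, g (x + y) * H y * moyalPhase (2 * B y x) ∂μ) *
      moyalPhase (-(2 * B w x)) = c * ∫ y, g (x + y) * H y * moyalPhase (2 * B y x) *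
        moyalPhase (-(2 * B w x)) ∂μ := by
    intro x
    rw [integral_mul_const, mul_assoc]
  simp_rw [e1]
  rw [integral_const_mul, integral_integral_swap hint]
  congr 1
  refine integral_congr_ae (Filter.Eventually.of_forall fun y => ?_)
  dsimp only
  have e2 : ∀ x, g (x + y) * H y * moyalPhase (2 * B y x) * moyalPhase (-(2 * B w x)) =
      (H y * moyalPhase (2 * B (w - y) y)) *
      (fun u => g u * moyalPhase (-(2 * B (w - y) u))) (x + y) := by
    intro x
    have : 2 * B y x + -(2 * B w x) = 2 * B (w - y) y + -(2 * B (w - y) (x + y)) := by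
      simp only [map_add, map_sub, _root_.sub_apply]; ring
    have h := congrArg moyalPhase this
    rw [moyalPhase_add, moyalPhase_add] at h
    dsimp only
    linear_combination (g (x + y) * H y) * h
  simp_rw [e2]
  rw [integral_const_mul, integral_add_right_eq_self (μ := μ)
    (fun u => g u * moyalPhase (-(2 * B (w - y) u))) y]
  ring

lemma moyalR_moyalR (B : E →L[ℝ] E →L[ℝ] ℝ) (c : ℂ) (f G H : SchwartzMap E ℂ) (x : E) :
    moyalR μ B c (moyalR μ B c f G) H x = moyalR μ B c f (moyalT μ B c G H) x := by
  have hint : Integrable (Function.uncurry fun y w =>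
      f (x + w) * G (w - y) * H y * moyalPhase (2 * B (w - y) (x + y)) *
        moyalPhase (2 * B y x)) (μ.prod μ) := by
    obtain ⟨C, hC0, hC⟩ := schwartz_decay' f 0 0
    obtain ⟨K, hK⟩ := schwartz_tensor G H
    let s : (E × E) ≃L[ℝ] (E × E) := ContinuousLinearEquiv.equivOfInverse
      ((ContinuousLinearMap.snd ℝ E E - ContinuousLinearMap.fst ℝ E E).prod
        (ContinuousLinearMap.fst ℝ E E))
      ((ContinuousLinearMap.snd ℝ E E).prod
        (ContinuousLinearMap.fst ℝ E E + ContinuousLinearMap.snd ℝ E E))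
      (fun p => by simp) (fun p => by simp)
    have h1 : Integrable (SchwartzMap.compCLMOfContinuousLinearEquiv ℝ s K) (μ.prod μ) :=
      SchwartzMap.integrable _
    have h2 := h1.bdd_mul (f := fun p : E × E => f (x + p.2) *
        moyalPhase (2 * B (p.2 - p.1) (x + p.1)) * moyalPhase (2 * B p.1 x)) (c := C)
      (by
        refine Continuous.aestronglyMeasurable ?_
        refine ((f.continuous.comp (by fun_prop)).mul ?_).mul ?_
        · exact continuous_bphase B (by fun_prop) (by fun_prop) _
        · exact continuous_bphase B (by fun_prop) (by fun_prop) _)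
      (Filter.Eventually.of_forall fun p => by
        simpa [norm_moyalPhase] using hC (x + p.2))
    refine h2.congr (Filter.Eventually.of_forall fun p => ?_)
    obtain ⟨y, w⟩ := p
    rw [SchwartzMap.compCLMOfContinuousLinearEquiv_apply]
    have : s (y, w) = (w - y, y) := rfl
    simp only [Function.uncurry_apply_pair, Function.comp_apply, this, hK]
    ring
  unfold moyalR moyalT
  have e1 : ∀ y, (c * ∫ z, f (x + y + z) * G z * moyalPhase (2 * B z (x + y)) ∂μ) * H y *
      moyalPhase (2 * B y x) = c * ∫ w, f (x + w) * G (w - y) * H y *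
        moyalPhase (2 * B (w - y) (x + y)) * moyalPhase (2 * B y x) ∂μ := by
    intro y
    rw [← integral_sub_right_eq_self (μ := μ)
      (fun z => f (x + y + z) * G z * moyalPhase (2 * B z (x + y))) y, mul_assoc, mul_assoc,
      ← integral_mul_const]
    congr 1
    refine integral_congr_ae (Filter.Eventually.of_forall fun w => ?_)
    have : x + y + (w - y) = x + w := by abel
    simp only [this]
    ring
  simp_rw [e1]
  rw [integral_const_mul, integral_integral_swap hint]
  congr 1
  rw [← integral_const_mul]
  refine integral_congr_ae (Filter.Eventually.of_forall fun w => ?_)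
  dsimp only
  have e2 : ∀ y, f (x + w) * G (w - y) * H y * moyalPhase (2 * B (w - y) (x + y)) *
      moyalPhase (2 * B y x) = (f (x + w) * moyalPhase (2 * B w x)) *
        (G (w - y) * H y * moyalPhase (2 * B (w - y) y)) := by
    intro y
    have : 2 * B (w - y) (x + y) + 2 * B y x = 2 * B w x + 2 * B (w - y) y := by
      simp only [map_add, map_sub, _root_.sub_apply]; ring
    have h := congrArg moyalPhase this
    rw [moyalPhase_add, moyalPhase_add] at h
    linear_combination (f (x + w) * G (w - y) * H y) * h
  simp_rw [e2]
  rw [integral_const_mul]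
  ring

end MoyalAux

lemma thetaMatrix_mulVec_inj (D : ℕ) (hDeven : Even D) (θ : ℝ) (hθ : 0 < θ) (v : Fin D → ℝ)
    (hv : thetaMatrix D θ *ᵥ v = 0) : v = 0 := by
  obtain ⟨m, hm⟩ := hDeven
  ext i
  rcases Nat.mod_two_eq_zero_or_one (i : ℕ) with h | h
  · have hi : (i : ℕ) + 1 < D := by have := i.2; omega
    have h1 := congrFun hv ⟨i + 1, hi⟩
    rw [Matrix.mulVec, dotProduct, Finset.sum_eq_single i] at h1
    · have a : ((i : ℕ) + 1) % 2 = 1 := by omega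
      simp [thetaMatrix, a, hθ.ne'] at h1
      simpa using h1
    · intro j _ hj
      have hj' : (j : ℕ) ≠ i := fun h => hj (Fin.ext h)
      have a : ((i : ℕ) + 1) % 2 = 1 := by omega
      simp [thetaMatrix, a, hj']
    · simp
  · have hi : (i : ℕ) - 1 < D := by have := i.2; omega
    have h1 := congrFun hv ⟨i - 1, hi⟩
    have a : ((i : ℕ) - 1) % 2 = 0 := by omega
    have b : (i : ℕ) = (i : ℕ) - 1 + 1 := by omega
    rw [Matrix.mulVec, dotProduct, Finset.sum_eq_single i] at h1
    · simp [thetaMatrix, a, ← b, hθ.ne'] at h1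
      simpa using h1
    · intro j _ hj
      have hj' : (j : ℕ) ≠ i := fun h => hj (Fin.ext h)
      simp [thetaMatrix, a, ← b, hj']
    · simp

lemma thetaMatrix_det_ne_zero (D : ℕ) (hDeven : Even D) (θ : ℝ) (hθ : 0 < θ) :
    (thetaMatrix D θ).det ≠ 0 := by
  intro h
  obtain ⟨v, hv, hv0⟩ := Matrix.exists_mulVec_eq_zero_iff.2 h
  exact hv (thetaMatrix_mulVec_inj D hDeven θ hθ v hv0)

/-- The continuous bilinear form attached to a matrix. -/
noncomputable def moyalB {D : ℕ} (M : Matrix (Fin D) (Fin D) ℝ) :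
    (Fin D → ℝ) →L[ℝ] (Fin D → ℝ) →L[ℝ] ℝ :=
  LinearMap.toContinuousBilinearMap (Matrix.toBilin' M)

lemma moyalB_apply {D : ℕ} (M : Matrix (Fin D) (Fin D) ℝ) (y z : Fin D → ℝ) :
    moyalB M y z = y ⬝ᵥ M *ᵥ z := by
  simp [moyalB, Matrix.toBilin'_apply']

lemma moyalS_schwartz {D : ℕ} (M : Matrix (Fin D) (Fin D) ℝ) (hM : M.det ≠ 0)
    (g : SchwartzMap (Fin D → ℝ) ℂ) :
    ∃ G : SchwartzMap (Fin D → ℝ) ℂ, ⇑G = moyalS volume (moyalB M) g := by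
  let g' : SchwartzMap (EuclideanSpace ℝ (Fin D)) ℂ :=
    SchwartzMap.compCLMOfContinuousLinearEquiv ℝ (EuclideanSpace.equiv (Fin D) ℝ) g
  let A : (Fin D → ℝ) ≃ₗ[ℝ] (Fin D → ℝ) :=
    LinearEquiv.ofInjectiveEndo (Matrix.mulVecLin (Real.pi⁻¹ • Mᵀ)) (by
      rw [← LinearMap.ker_eq_bot, LinearMap.ker_eq_bot']
      intro v hv
      by_contra hne
      have h0 : (Real.pi⁻¹ • Mᵀ).det = 0 := Matrix.exists_mulVec_eq_zero_iff.1 ⟨v, hne, hv⟩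
      rw [Matrix.det_smul, Matrix.det_transpose] at h0
      have := Real.pi_ne_zero
      simp_all)
  let e : (Fin D → ℝ) ≃L[ℝ] EuclideanSpace ℝ (Fin D) :=
    A.toContinuousLinearEquiv.trans (EuclideanSpace.equiv (Fin D) ℝ).symm
  refine ⟨SchwartzMap.compCLMOfContinuousLinearEquiv ℝ e (FourierTransform.fourier g'), ?_⟩
  ext y
  rw [SchwartzMap.compCLMOfContinuousLinearEquiv_apply, Function.comp_apply,
    SchwartzMap.fourier_coe, Real.fourier_eq', moyalS,
    ← (PiLp.volume_preserving_ofLp (Fin D)).integral_comp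
      (MeasurableEquiv.toLp 2 (Fin D → ℝ)).symm.measurableEmbedding]
  refine integral_congr_ae (Filter.Eventually.of_forall fun v => ?_)
  have h1 : g' v = g v.ofLp := rfl
  have h2 : inner ℝ v (e y) = Real.pi⁻¹ * moyalB M y v.ofLp := by
    have : (e y).ofLp = (Real.pi⁻¹ • Mᵀ) *ᵥ y := rfl
    rw [EuclideanSpace.inner_eq_star_dotProduct, this, moyalB_apply, Matrix.smul_mulVec,
      smul_dotProduct, Matrix.mulVec_transpose, Matrix.dotProduct_mulVec]
    simp
  dsimp only
  rw [h1, h2, smul_eq_mul, mul_comm, moyalPhase, mul_comm Complex.I]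
  congr 4
  have := Real.pi_ne_zero
  field_simp

/-- The Moyal product of two Schwartz functions on `ℝ^D` is again a
Schwartz function, and the Moyal product is associative on Schwartz functions. -/
theorem statement11 (D : ℕ) (hD : 0 < D) (hDeven : Even D) (θ : ℝ) (hθ : 0 < θ) :
    (∀ f g : SchwartzMap (Fin D → ℝ) ℂ,
      ∃ p : SchwartzMap (Fin D → ℝ) ℂ, ⇑p = moyalProd D θ ⇑f ⇑g) ∧
    (∀ f g h : SchwartzMap (Fin D → ℝ) ℂ,
      moyalProd D θ (moyalProd D θ ⇑f ⇑g) ⇑h =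
        moyalProd D θ ⇑f (moyalProd D θ ⇑g ⇑h)) := by
  set M := (thetaMatrix D θ)⁻¹ with hMdef
  have hM : M.det ≠ 0 := by
    rw [hMdef, Matrix.det_nonsing_inv]
    have := thetaMatrix_det_ne_zero D hDeven θ hθ
    simpa using this
  set c : ℂ := ((Real.pi ^ D * |(thetaMatrix D θ).det| : ℝ) : ℂ)⁻¹ with hc
  have hprod : ∀ f g : (Fin D → ℝ) → ℂ,
      moyalProd D θ f g = moyalR volume (moyalB M) c f (moyalS volume (moyalB M) g) := by
    intro f g
    ext x
    rw [← moyal_eq_moyalR]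
    unfold moyalProd
    rw [← hc]
    congr 1
    refine integral_congr_ae (Filter.Eventually.of_forall fun y => ?_)
    refine integral_congr_ae (Filter.Eventually.of_forall fun z => ?_)
    dsimp only
    rw [moyalPhase, moyalB_apply]
    congr 2
    push_cast
    ring
  refine ⟨fun f g => ?_, fun f g h => ?_⟩
  · obtain ⟨G, hG⟩ := moyalS_schwartz M hM g
    obtain ⟨K, hK⟩ := schwartz_twisted f G (moyalB M)
    obtain ⟨p, hp⟩ := schwartz_integrate_out volume K
    refine ⟨c • p, ?_⟩
    rw [hprod, ← hG]
    ext x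
    simp only [_root_.smul_apply, smul_eq_mul, hp, hK, moyalR]
  · obtain ⟨G, hG⟩ := moyalS_schwartz M hM g
    obtain ⟨H, hH⟩ := moyalS_schwartz M hM h
    rw [hprod, hprod f g, hprod f, hprod g h, ← hG, ← hH]
    ext x
    rw [moyalR_moyalR, funext (moyalS_moyalR volume (moyalB M) c g H), ← hG]
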